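/- arXiv:1608.07504 — 2 statements merged into one kernel-verified Lean document; each statement's English description precedes it below -/
import Mathlib

section
/- If a linear map κ : Λ²V → H has the Jacobi property, then (z,u,v | x,y) = 0 in Λ³V ⊗ H for all z, u, v, x, y ∈ V. -/
open TensorProduct

section HopfHecke

variable (F H V : Type*) [Field F] [CharZero F] [Ring H] [HopfAlgebra F H]
  [AddCommGroup V] [Module F V] [Module H V] [IsScalarTower F H V]

/-- The "triangle" operation `h ▷ v := h • v − ε(h) • v`, as a bilinear map. -/
noncomputable def trb : H →ₗ[F] V →ₗ[F] V :=
  LinearMap.mk₂ F (fun h v => h • v - Coalgebra.counit (R := F) h • v)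
    (fun h h' v => by simp [add_smul, map_add]; abel)
    (fun c h v => by simp [smul_assoc, smul_sub, smul_smul])
    (fun h v v' => by simp [smul_add]; abel)
    (fun c h v => by simp [smul_comm c, smul_sub])

/-- The Sweedler-style element
`(h₍₁₎ ▷ v₁) ∧ ⋯ ∧ (h₍k₎ ▷ v_k) ⊗ h₍k₊₁₎ ∈ ΛV ⊗ H`, as a linear map in `h`. -/
noncomputable def sweedlerWedge : (k : ℕ) → (Fin k → V) →
    (H →ₗ[F] ExteriorAlgebra F V ⊗[F] H)
  | 0, _ => TensorProduct.mk F (ExteriorAlgebra F V) H 1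
  | (k+1), vs =>
      TensorProduct.lift
        (((LinearMap.llcomp F H (ExteriorAlgebra F V ⊗[F] H) (ExteriorAlgebra F V ⊗[F] H)).flip
            (sweedlerWedge k (fun i => vs i.succ))) ∘ₗ
          (LinearMap.rTensorHom (M := H)) ∘ₗ (LinearMap.mul F (ExteriorAlgebra F V)) ∘ₗ
          (ExteriorAlgebra.ι F) ∘ₗ ((trb F H V).flip (vs 0))) ∘ₗ
        (Coalgebra.comul (R := F))

/-- Applying the counit to the trailing tensor factor; composing this with
`sweedlerWedge (i+1) vs` gives `(h₍₁₎ ▷ v₁) ∧ ⋯ ∧ (h₍ᵢ₊₁₎ ▷ v_{i+1}) ∈ ΛV`. -/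
noncomputable def purify : ExteriorAlgebra F V ⊗[F] H →ₗ[F] ExteriorAlgebra F V :=
  (TensorProduct.rid F (ExteriorAlgebra F V)).toLinearMap ∘ₗ
    (LinearMap.lTensor (ExteriorAlgebra F V) (Coalgebra.counit (R := F)))

/-- The subspace `K'_i ⊆ H` of elements `h` with
`(h₍₁₎ ▷ v₁) ∧ ⋯ ∧ (h₍ᵢ₊₁₎ ▷ v_{i+1}) = 0` for all `v₁, …, v_{i+1} ∈ V`. -/
noncomputable def Kp (i : ℕ) : Submodule F H :=
  ⨅ vs : Fin (i+1) → V,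
    LinearMap.ker ((purify F H V) ∘ₗ (sweedlerWedge F H V (i+1) vs))

/-- The subspace `K_i := Δ⁻¹(K'_i ⊗ H) ⊆ H`. -/
noncomputable def K (i : ℕ) : Submodule F H :=
  Submodule.comap (Coalgebra.comul (R := F))
    (LinearMap.range (TensorProduct.map (Kp F H V i).subtype (LinearMap.id (M := H))))

end HopfHecke

section Jacobi

variable (F H V : Type*) [Field F] [CharZero F] [Ring H] [HopfAlgebra F H]
  [AddCommGroup V] [Module F V] [Module H V] [IsScalarTower F H V]

/-- The Sweedler-style element `(h₍₁₎ ▷ v) ⊗ h₍₂₎ ∈ V ⊗ H`. -/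
noncomputable def Jmap (h : H) (v : V) : V ⊗[F] H :=
  TensorProduct.map ((trb F H V).flip v) LinearMap.id (Coalgebra.comul (R := F) h)

/-- A bilinear alternating map `κ : Λ²V → H` has the Jacobi property if
`(κ(x,y)₍₁₎ ▷ z) ⊗ κ(x,y)₍₂₎ + (κ(y,z)₍₁₎ ▷ x) ⊗ κ(y,z)₍₂₎ + (κ(z,x)₍₁₎ ▷ y) ⊗ κ(z,x)₍₂₎ = 0`
in `V ⊗ H` for all `x, y, z ∈ V`. -/
def HasJacobi (κ : V →ₗ[F] V →ₗ[F] H) : Prop :=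
  ∀ x y z : V,
    Jmap F H V (κ x y) z + Jmap F H V (κ y z) x + Jmap F H V (κ z x) y = 0

end Jacobi

/-- A function of five arguments that is skew in the first three and in the last two, and whose
cyclic sums over the first and the last two arguments vanish, is zero. -/
theorem eq_zero_of_skew_of_cyclic {F V M : Type*} [Field F] [CharZero F] [AddCommGroup M]
    [Module F M] (f : V → V → V → V → V → M)
    (h₁₂ : ∀ a b c x y, f b a c x y = -f a b c x y)
    (h₂₃ : ∀ a b c x y, f a c b x y = -f a b c x y)
    (h₄₅ : ∀ a b c x y, f a b c y x = -f a b c x y)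
    (hcyc : ∀ z u v x y, f z u v x y + f x u v y z + f y u v z x = 0) (a b c x y : V) :
    f a b c x y = 0 := by
  have h₁₃ : ∀ a b c x y, f c b a x y = -f a b c x y := fun a b c x y => by
    rw [h₁₂ b c a, h₂₃ b a c, h₁₂ a b c, neg_neg]
  have key : (6 : F) • f a b c x y = 0 := by
    have e₀ : ∀ a b c x y, f a b c x y - f x b c a y + f y b c a x = 0 := fun a b c x y => by
      rw [← hcyc a b c x y, h₄₅ x b c a y, sub_eq_add_neg]
    have e₁ : ∀ a b c x y, f a x y b c - f a x c b y + f a x b c y = 0 := fun a b c x y => by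
      have := hcyc y a x b c
      rw [h₄₅ c a x b y, h₁₂ a y x b c, h₁₂ a b x c y, h₁₂ a c x b y, h₂₃ a x y b c,
        h₂₃ a x b c y, h₂₃ a x c b y] at this
      rw [← this]; abel
    have p := e₀ a b c x y
    have q := e₀ b c a x y
    have r := e₀ c a b x y
    have s := hcyc a x y b c
    have t₁ := e₁ a b c x y
    have t₂ := e₁ a b c y x
    have t₃ := e₁ b c a x y
    have t₄ := e₁ b c a y x
    have t₅ := e₁ c a b x y
    have t₆ := e₁ c a b y x
    simp only [h₁₂ a c b, h₁₃ a c b, h₂₃ a b c, h₂₃ x a b, h₂₃ x a c, h₂₃ x b c, h₂₃ y a b,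
      h₂₃ y a c, h₂₃ y b c, h₁₂ x a, h₁₂ x b, h₁₂ x c, h₁₂ y a, h₁₂ y b, h₁₂ y c,
      h₁₃ x a y, h₁₃ x b y, h₁₃ x c y, h₄₅ _ _ _ a c] at p q r s t₁ t₂ t₃ t₄ t₅ t₆
    linear_combination (norm := module) (2 : F) • p + (2 : F) • q + (2 : F) • r + (2 : F) • s
      - t₁ + t₂ - t₃ + t₄ - t₅ + t₆
  exact (smul_eq_zero.mp key).resolve_left (by norm_num)

section

variable {F H V : Type*} [Field F] [Ring H] [HopfAlgebra F H] [AddCommGroup V] [Module F V]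

/-- The map `v ⊗ h ↦ ι v * φ h`, where `ι v` multiplies the first tensor factor. -/
noncomputable def wedgeLeft (φ : H →ₗ[F] ExteriorAlgebra F V ⊗[F] H) :
    V ⊗[F] H →ₗ[F] ExteriorAlgebra F V ⊗[F] H :=
  TensorProduct.lift
    (((LinearMap.llcomp F H (ExteriorAlgebra F V ⊗[F] H) (ExteriorAlgebra F V ⊗[F] H)).flip φ) ∘ₗ
      (LinearMap.rTensorHom (M := H)) ∘ₗ (LinearMap.mul F (ExteriorAlgebra F V)) ∘ₗ
      (ExteriorAlgebra.ι F))

@[simp]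
theorem wedgeLeft_tmul (φ : H →ₗ[F] ExteriorAlgebra F V ⊗[F] H) (v : V) (h : H) :
    wedgeLeft φ (v ⊗ₜ h) =
      (LinearMap.mulLeft F (ExteriorAlgebra.ι F v)).rTensor H (φ h) := rfl

theorem wedgeLeft_neg (φ : H →ₗ[F] ExteriorAlgebra F V ⊗[F] H) (t : V ⊗[F] H) :
    wedgeLeft (-φ) t = -wedgeLeft φ t := by
  induction t with
  | zero => simp
  | tmul a b => simp
  | add s t hs ht => simp only [map_add, hs, ht, neg_add]

theorem mulLeft_ι_swap (v w : V) (t : ExteriorAlgebra F V ⊗[F] H) :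
    (LinearMap.mulLeft F (ExteriorAlgebra.ι F w)).rTensor H
        ((LinearMap.mulLeft F (ExteriorAlgebra.ι F v)).rTensor H t) =
      -(LinearMap.mulLeft F (ExteriorAlgebra.ι F v)).rTensor H
        ((LinearMap.mulLeft F (ExteriorAlgebra.ι F w)).rTensor H t) := by
  induction t with
  | zero => simp
  | tmul a b =>
    have h := ExteriorAlgebra.ι_add_mul_swap (R := F) w v
    simp only [LinearMap.rTensor_tmul, LinearMap.mulLeft_apply, ← mul_assoc,
      eq_neg_of_add_eq_zero_left h, neg_mul, TensorProduct.neg_tmul]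
  | add s t hs ht => simp only [map_add, hs, ht, neg_add]

theorem comul_leftComm
    (hcc : ∀ h : H, (TensorProduct.comm F H H) (Coalgebra.comul h) = Coalgebra.comul h) (h : H) :
    TensorProduct.leftComm F H H H ((Coalgebra.comul (R := F)).lTensor H (Coalgebra.comul h)) =
      (Coalgebra.comul (R := F)).lTensor H (Coalgebra.comul h) := by
  rw [← Coalgebra.coassoc_apply]
  generalize (Coalgebra.comul (R := F) h) = t
  induction t with
  | zero => simp
  | tmul a b =>
    rw [LinearMap.rTensor_tmul]
    conv_rhs => rw [← hcc a]
    generalize (Coalgebra.comul (R := F) a) = s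
    induction s with
    | zero => simp
    | tmul c d => simp
    | add s t hs ht => simp only [map_add, hs, ht, TensorProduct.add_tmul]
  | add s t hs ht => simp only [map_add, hs, ht]

variable [Module H V] [IsScalarTower F H V]

theorem sweedlerWedge_succ (k : ℕ) (vs : Fin (k + 1) → V) (h : H) :
    sweedlerWedge F H V (k + 1) vs h =
      wedgeLeft (sweedlerWedge F H V k fun i => vs i.succ) (Jmap F H V h (vs 0)) := by
  simp only [sweedlerWedge, Jmap, LinearMap.comp_apply]
  generalize (Coalgebra.comul (R := F) h) = t
  induction t with
  | zero => simp
  | tmul a b => simp; rfl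
  | add s t hs ht => simp only [map_add, hs, ht]

theorem sweedlerWedge_swap_first
    (hcc : ∀ h : H, (TensorProduct.comm F H H) (Coalgebra.comul h) = Coalgebra.comul h)
    (k : ℕ) (u v : V) (ws : Fin k → V) (h : H) :
    sweedlerWedge F H V (k + 2) (Matrix.vecCons v (Matrix.vecCons u ws)) h =
      -sweedlerWedge F H V (k + 2) (Matrix.vecCons u (Matrix.vecCons v ws)) h := by
  set φ := sweedlerWedge F H V k ws
  let Ψ : V → V → H ⊗[F] (H ⊗[F] H) →ₗ[F] ExteriorAlgebra F V ⊗[F] H := fun u v =>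
    TensorProduct.lift (((LinearMap.llcomp F (H ⊗[F] H) (ExteriorAlgebra F V ⊗[F] H)
        (ExteriorAlgebra F V ⊗[F] H)).flip
          (wedgeLeft φ ∘ₗ TensorProduct.map ((trb F H V).flip v) LinearMap.id)) ∘ₗ
      (LinearMap.rTensorHom (M := H)) ∘ₗ (LinearMap.mul F (ExteriorAlgebra F V)) ∘ₗ
      (ExteriorAlgebra.ι F) ∘ₗ (trb F H V).flip u)
  have hΨ (u v : V) (a b c : H) : Ψ u v (a ⊗ₜ (b ⊗ₜ c)) =
      (LinearMap.mulLeft F (ExteriorAlgebra.ι F (trb F H V a u))).rTensor H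
        ((LinearMap.mulLeft F (ExteriorAlgebra.ι F (trb F H V b v))).rTensor H (φ c)) := rfl
  have hsw (u v : V) : sweedlerWedge F H V (k + 2) (Matrix.vecCons u (Matrix.vecCons v ws)) h =
      Ψ u v ((Coalgebra.comul (R := F)).lTensor H (Coalgebra.comul h)) := by
    rw [sweedlerWedge_succ, Jmap]
    generalize (Coalgebra.comul (R := F) h) = t
    induction t with
    | zero => simp
    | tmul a b =>
      rw [TensorProduct.map_tmul, wedgeLeft_tmul, LinearMap.id_apply, sweedlerWedge_succ]
      rfl
    | add s t hs ht => simp only [map_add, hs, ht]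
  have hswap (t : H ⊗[F] (H ⊗[F] H)) :
      Ψ v u (TensorProduct.leftComm F H H H t) = -Ψ u v t := by
    suffices Ψ v u ∘ₗ (TensorProduct.leftComm F H H H).toLinearMap = -Ψ u v from
      LinearMap.congr_fun this t
    ext a b c
    exact mulLeft_ι_swap _ _ _
  rw [hsw, hsw, ← hswap, comul_leftComm hcc]

end

/-- If a linear map `κ : Λ²V → H` (encoded as an alternating bilinear
map `V × V → H`) has the Jacobi property, then `(z,u,v | x,y) = 0` in `Λ³V ⊗ H`
for all `z, u, v, x, y ∈ V`, where
`(v₁,…,v_k | x,y) := (κ(x,y)₍₁₎ ▷ v₁) ∧ ⋯ ∧ (κ(x,y)₍k₎ ▷ v_k) ⊗ κ(x,y)₍k₊₁₎`. -/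
theorem stmt_6 (F H V : Type*) [Field F] [CharZero F] [Ring H] [HopfAlgebra F H]
    -- cocommutativity of `H`
    (hcc : ∀ h : H, (TensorProduct.comm F H H) (Coalgebra.comul h) = Coalgebra.comul h)
    [AddCommGroup V] [Module F V] [Module H V] [IsScalarTower F H V]
    [Module.Finite F V]
    (κ : V →ₗ[F] V →ₗ[F] H) (halt : ∀ v : V, κ v v = 0)
    (hjac : HasJacobi F H V κ) :
    ∀ z u v x y : V, sweedlerWedge F H V 3 ![z, u, v] (κ x y) = 0 := by
  intro z u v x y
  refine eq_zero_of_skew_of_cyclic (F := F)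
    (fun z u v x y => sweedlerWedge F H V 3 ![z, u, v] (κ x y))
    (fun a b c x y => sweedlerWedge_swap_first hcc 1 a b ![c] _) (fun a b c x y => ?_)
    (fun a b c x y => ?_) (fun z u v x y => ?_) z u v x y
  · have h : sweedlerWedge F H V 2 ![c, b] = -sweedlerWedge F H V 2 ![b, c] :=
      LinearMap.ext fun g => sweedlerWedge_swap_first hcc 0 b c ![] g
    rw [sweedlerWedge_succ, sweedlerWedge_succ]
    change wedgeLeft (sweedlerWedge F H V 2 ![c, b]) _ = _
    rw [h, wedgeLeft_neg]
    rfl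
  · have h : κ y x = -κ x y := by
      have := halt (x + y)
      simp only [map_add, LinearMap.add_apply, halt, zero_add, add_zero] at this
      exact eq_neg_of_add_eq_zero_left this
    rw [h, map_neg]
  · have h := congrArg (wedgeLeft (sweedlerWedge F H V 2 ![u, v])) (hjac x y z)
    simp only [map_add, map_zero] at h
    simp only [sweedlerWedge_succ 2]
    exact h
end

section
/- If a linear map κ : Λ²V → H has the Jacobi property, then the image of κ is contained in K_2. -/
open TensorProduct

/-- An alternating map `κ` whose cyclic sums vanish under anticommuting operators `T` is
annihilated by all triple products of these operators. -/
theorem triple_apply_eq_zero_of_anticomm {F V M : Type*} [Field F] [CharZero F]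
    [AddCommGroup V] [Module F V] [AddCommGroup M] [Module F M]
    (T : V → M →ₗ[F] M) (hT : ∀ v w m, T v (T w m) = -T w (T v m))
    (κ : V → V → M) (hκ : ∀ x y, κ x y = -κ y x)
    (hJ : ∀ x y z, T z (κ x y) + T x (κ y z) + T y (κ z x) = 0) (u v w x y : V) :
    T w (T v (T u (κ x y))) = 0 := by
  have move (x y z : V) : T z (κ x y) = T x (κ z y) + T y (κ x z) := by
    have h := hJ x y z
    rw [hκ y z, hκ z x, map_neg, map_neg] at h
    linear_combination (norm := module) h
  have expand (v w x y : V) : T v (T w (κ x y)) =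
      -T x (T w (κ v y)) - T y (T w (κ x v)) + (2 : F) • T x (T y (κ v w)) := by
    rw [move x y w, map_add, hT v x, hT v y, move w y v, move x w v, map_add, map_add,
      hκ w v, map_neg, map_neg, hT y x]
    module
  have symm (v w x y : V) : T v (T w (κ x y)) = T x (T y (κ v w)) := by
    have h₁ := expand v w x y
    have h₂ := expand w v x y
    have h₃ := congrArg (T x) (move v y w)
    have h₄ := congrArg (T y) (move x v w)
    rw [map_add] at h₃ h₄
    rw [hT w v, hκ w v, map_neg, map_neg] at h₂
    rw [hT y x, hκ w v, map_neg, map_neg, neg_neg] at h₄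
    have h₅ : (2 : F) • T v (T w (κ x y)) = (2 : F) • T x (T y (κ v w)) := by
      linear_combination (norm := module) h₁ - h₂ - h₃ - h₄
    exact smul_right_injective M (two_ne_zero (α := F)) h₅
  have cyc := congrArg (fun m => T x (T y m)) (hJ v u w)
  simp only [map_add, map_zero] at cyc
  have swap (a b c : V) : T x (T y (T c (κ a b))) = T c (T a (T b (κ x y))) := by
    rw [hT y c, map_neg, hT x c, neg_neg, symm x y a b]
  have rot₁ : T v (T u (T w (κ x y))) = T w (T v (T u (κ x y))) := by
    rw [hT u w, map_neg, hT v w, neg_neg]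
  have rot₂ : T u (T w (T v (κ x y))) = T w (T v (T u (κ x y))) := by
    rw [hT u w, hT u v, map_neg, neg_neg]
  rw [swap, swap, swap, rot₁, rot₂] at cyc
  refine (smul_eq_zero_iff_right (three_ne_zero (α := F))).1 ?_
  linear_combination (norm := module) cyc

section WedgeOperator

variable (F H V : Type*) [Field F] [Ring H] [HopfAlgebra F H]
  [AddCommGroup V] [Module F V] [Module H V] [IsScalarTower F H V]

/-- The operator `a ⊗ h ↦ a ∧ (h₍₁₎ ▷ v) ⊗ h₍₂₎` on `ΛV ⊗ H`. -/
noncomputable def wedgeOp (v : V) :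
    ExteriorAlgebra F V ⊗[F] H →ₗ[F] ExteriorAlgebra F V ⊗[F] H :=
  (LinearMap.mul' F (ExteriorAlgebra F V)).rTensor H ∘ₗ
    (TensorProduct.assoc F (ExteriorAlgebra F V) (ExteriorAlgebra F V) H).symm.toLinearMap ∘ₗ
    (((ExteriorAlgebra.ι F) ∘ₗ (trb F H V).flip v).rTensor H ∘ₗ
      Coalgebra.comul (R := F)).lTensor (ExteriorAlgebra F V)

/-- The map `b ⊗ h ↦ a ∧ (b ▷ v) ⊗ h`. -/
noncomputable def wedgeRight (a : ExteriorAlgebra F V) (v : V) : H →ₗ[F] ExteriorAlgebra F V :=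
  LinearMap.mulLeft F a ∘ₗ ExteriorAlgebra.ι F ∘ₗ (trb F H V).flip v

variable {F H V}

theorem wedgeOp_tmul (v : V) (a : ExteriorAlgebra F V) (h : H) :
    wedgeOp F H V v (a ⊗ₜ h) = (wedgeRight F H V a v).rTensor H (Coalgebra.comul h) := by
  simp only [wedgeOp, LinearMap.comp_apply, LinearMap.lTensor_tmul]
  induction (Coalgebra.comul h : H ⊗[F] H) with
  | zero => simp
  | add s t hs ht => simp only [map_add, tmul_add, hs, ht]
  | tmul s t => simp [wedgeRight]

theorem wedgeOp_one_tmul (v : V) (h : H) :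
    wedgeOp F H V v (1 ⊗ₜ h) = (ExteriorAlgebra.ι F).rTensor H (Jmap F H V h v) := by
  rw [wedgeOp_tmul, Jmap]
  induction (Coalgebra.comul h : H ⊗[F] H) with
  | zero => simp
  | add s t hs ht => simp only [map_add, hs, ht]
  | tmul s t => simp [wedgeRight]

theorem rTensor_mulLeft_wedgeOp (v : V) (a : ExteriorAlgebra F V)
    (t : ExteriorAlgebra F V ⊗[F] H) :
    (LinearMap.mulLeft F a).rTensor H (wedgeOp F H V v t) =
      wedgeOp F H V v ((LinearMap.mulLeft F a).rTensor H t) := by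
  induction t with
  | zero => simp
  | add s t hs ht => simp only [map_add, hs, ht]
  | tmul b h =>
    rw [LinearMap.rTensor_tmul, wedgeOp_tmul, wedgeOp_tmul]
    induction (Coalgebra.comul h : H ⊗[F] H) with
    | zero => simp
    | add s t hs ht => simp only [map_add, hs, ht]
    | tmul s t => simp [wedgeRight]

theorem rTensor_wedgeOp_coassoc (v : V) (t : ExteriorAlgebra F V ⊗[F] H) :
    (wedgeOp F H V v).rTensor H ((TensorProduct.assoc F _ H H).symm
        ((Coalgebra.comul (R := F)).lTensor (ExteriorAlgebra F V) t)) =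
      (TensorProduct.assoc F _ H H).symm
        ((Coalgebra.comul (R := F)).lTensor (ExteriorAlgebra F V) (wedgeOp F H V v t)) := by
  induction t with
  | zero => simp
  | add s t hs ht => simp only [map_add, hs, ht]
  | tmul a h =>
    have h₁ (s : H ⊗[F] H) :
        (wedgeOp F H V v).rTensor H ((TensorProduct.assoc F _ H H).symm (a ⊗ₜ s)) =
          ((wedgeRight F H V a v).rTensor H).rTensor H
            ((Coalgebra.comul (R := F)).rTensor H s) := by
      induction s with
      | zero => simp
      | add s t hs ht => simp only [map_add, tmul_add, hs, ht]
      | tmul s t => simp [wedgeOp_tmul]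
    have h₂ (s : H ⊗[F] (H ⊗[F] H)) :
        ((wedgeRight F H V a v).rTensor H).rTensor H ((TensorProduct.assoc F H H H).symm s) =
          (TensorProduct.assoc F _ H H).symm ((wedgeRight F H V a v).rTensor (H ⊗[F] H) s) := by
      induction s with
      | zero => simp
      | add s t hs ht => simp only [map_add, hs, ht]
      | tmul s t =>
        induction t with
        | zero => simp
        | add p q hp hq => simp only [map_add, tmul_add, hp, hq]
        | tmul p q => simp
    rw [LinearMap.lTensor_tmul, h₁, ← Coalgebra.coassoc_symm_apply, h₂, wedgeOp_tmul]
    congr 1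
    exact LinearMap.congr_fun ((LinearMap.rTensor_comp_lTensor _ _ _).trans
      (LinearMap.lTensor_comp_rTensor _ _ _).symm) (Coalgebra.comul h)

theorem wedgeOp_anticomm
    (hcc : ∀ h : H, (TensorProduct.comm F H H) (Coalgebra.comul h) = Coalgebra.comul h)
    (v w : V) (t : ExteriorAlgebra F V ⊗[F] H) :
    wedgeOp F H V v (wedgeOp F H V w t) = -wedgeOp F H V w (wedgeOp F H V v t) := by
  induction t with
  | zero => simp
  | add s t hs ht => simp only [map_add, hs, ht, neg_add]
  | tmul a h =>
    let φ (v w : V) : H ⊗[F] H →ₗ[F] ExteriorAlgebra F V :=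
      LinearMap.mul' F (ExteriorAlgebra F V) ∘ₗ
        TensorProduct.map (wedgeRight F H V a w) (wedgeRight F H V 1 v)
    have h₁ (v w : V) : wedgeOp F H V v (wedgeOp F H V w (a ⊗ₜ h)) =
        (φ v w ∘ₗ Coalgebra.comul).rTensor H (Coalgebra.comul h) := by
      rw [LinearMap.rTensor_comp_apply, ← Coalgebra.coassoc_symm_apply, wedgeOp_tmul]
      induction (Coalgebra.comul h : H ⊗[F] H) with
      | zero => simp
      | add s t hs ht => simp only [map_add, hs, ht]
      | tmul s t =>
        rw [LinearMap.rTensor_tmul, LinearMap.lTensor_tmul, wedgeOp_tmul]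
        induction (Coalgebra.comul t : H ⊗[F] H) with
        | zero => simp
        | add p q hp hq => simp only [map_add, tmul_add, hp, hq]
        | tmul p q => simp [φ, wedgeRight, mul_assoc]
    have h₂ : φ v w ∘ₗ (TensorProduct.comm F H H).toLinearMap = -φ w v := by
      ext s t
      have := ExteriorAlgebra.ι_add_mul_swap (R := F) (trb F H V t w) (trb F H V s v)
      simp [φ, wedgeRight, mul_assoc, ← mul_neg, eq_neg_of_add_eq_zero_left this]
    have h₃ : φ v w ∘ₗ Coalgebra.comul = -(φ w v ∘ₗ Coalgebra.comul) := by
      ext h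
      simpa [hcc] using congrArg (fun f => f (Coalgebra.comul h)) h₂
    rw [h₁, h₁, h₃, LinearMap.rTensor_neg, LinearMap.neg_apply]

theorem sweedlerWedge_succ_apply (k : ℕ) (vs : Fin (k + 1) → V)
    (P : ExteriorAlgebra F V ⊗[F] H →ₗ[F] ExteriorAlgebra F V ⊗[F] H)
    (hP : ∀ a t, (LinearMap.mulLeft F a).rTensor H (P t) = P ((LinearMap.mulLeft F a).rTensor H t))
    (hk : ∀ h, sweedlerWedge F H V k (fun i => vs i.succ) h = P (1 ⊗ₜ h)) (h : H) :
    sweedlerWedge F H V (k + 1) vs h = P (wedgeOp F H V (vs 0) (1 ⊗ₜ h)) := by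
  rw [sweedlerWedge, LinearMap.comp_apply, wedgeOp_tmul]
  induction (Coalgebra.comul h : H ⊗[F] H) with
  | zero => simp
  | add s t hs ht => simp only [map_add, hs, ht]
  | tmul s t =>
    have hmul (a : ExteriorAlgebra F V) : LinearMap.mul F _ a = LinearMap.mulLeft F a := rfl
    have := hP (ExteriorAlgebra.ι F (trb F H V s (vs 0))) (1 ⊗ₜ t)
    simpa [wedgeRight, hk, hmul] using this

theorem sweedlerWedge_three_apply (vs : Fin 3 → V) (h : H) :
    sweedlerWedge F H V 3 vs h =
      wedgeOp F H V (vs 2) (wedgeOp F H V (vs 1) (wedgeOp F H V (vs 0) (1 ⊗ₜ h))) := by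
  refine sweedlerWedge_succ_apply 2 vs (wedgeOp F H V (vs 2) ∘ₗ wedgeOp F H V (vs 1))
    (fun a t => by simp [rTensor_mulLeft_wedgeOp]) (fun h => ?_) h
  refine sweedlerWedge_succ_apply 1 _ (wedgeOp F H V (vs 2))
    (fun a t => by simp [rTensor_mulLeft_wedgeOp]) (fun h => ?_) h
  exact sweedlerWedge_succ_apply 0 _ LinearMap.id (fun a t => rfl) (fun h => rfl) h

theorem rTensor_sweedlerWedge_three_comul (vs : Fin 3 → V) (h : H) :
    (sweedlerWedge F H V 3 vs).rTensor H (Coalgebra.comul h) =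
      (TensorProduct.assoc F _ H H).symm
        ((Coalgebra.comul (R := F)).lTensor _ (sweedlerWedge F H V 3 vs h)) := by
  have h₁ : sweedlerWedge F H V 3 vs = wedgeOp F H V (vs 2) ∘ₗ wedgeOp F H V (vs 1) ∘ₗ
      wedgeOp F H V (vs 0) ∘ₗ TensorProduct.mk F (ExteriorAlgebra F V) H 1 := by
    ext h
    simp [sweedlerWedge_three_apply]
  have h₂ (s : H ⊗[F] H) : (TensorProduct.mk F (ExteriorAlgebra F V) H 1).rTensor H s =
      (TensorProduct.assoc F _ H H).symm (1 ⊗ₜ s) := by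
    induction s with
    | zero => simp
    | add s t hs ht => simp only [map_add, tmul_add, hs, ht]
    | tmul s t => simp
  rw [sweedlerWedge_three_apply, ← rTensor_wedgeOp_coassoc, ← rTensor_wedgeOp_coassoc,
    ← rTensor_wedgeOp_coassoc, LinearMap.lTensor_tmul, h₁, ← h₂]
  simp only [LinearMap.rTensor_comp_apply]

end WedgeOperator

/-- Over a field, `(⨅ i, ker (f i)) ⊗ N` contains every tensor killed by all `f i ⊗ id`. -/
theorem mem_range_map_subtype_iInf_ker {F M N P ι : Type*} [Field F] [AddCommGroup M] [Module F M]
    [AddCommGroup N] [Module F N] [AddCommGroup P] [Module F P] (f : ι → M →ₗ[F] P)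
    (t : M ⊗[F] N) (ht : ∀ i, (f i).rTensor N t = 0) :
    t ∈ LinearMap.range (TensorProduct.map (⨅ i, LinearMap.ker (f i)).subtype
      (LinearMap.id (M := N))) := by
  obtain ⟨c, rfl⟩ := TensorProduct.eq_repr_basis_right (Module.Basis.ofVectorSpace F N) t
  refine Submodule.sum_mem _ fun j _ => ?_
  have hc : c j ∈ ⨅ i, LinearMap.ker (f i) := by
    refine Submodule.mem_iInf _ |>.2 fun i => ?_
    have h := ht i
    have h' := TensorProduct.sum_tmul_basis_right_eq_zero (Module.Basis.ofVectorSpace F N)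
      (c.mapRange (f i) (map_zero _)) (by
        rw [Finsupp.sum_mapRange_index (by simp)]
        simpa [Finsupp.sum] using h)
    simpa using DFunLike.congr_fun h' j
  exact ⟨⟨c j, hc⟩ ⊗ₜ Module.Basis.ofVectorSpace F N j, by simp⟩

/-- If a linear map `κ : Λ²V → H` (encoded as an alternating bilinear
map `V × V → H`) has the Jacobi property, then the image of `κ` is contained in `K_2`. -/
theorem stmt_7 (F H V : Type*) [Field F] [CharZero F] [Ring H] [HopfAlgebra F H]
    -- cocommutativity of `H`
    (hcc : ∀ h : H, (TensorProduct.comm F H H) (Coalgebra.comul h) = Coalgebra.comul h)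
    [AddCommGroup V] [Module F V] [Module H V] [IsScalarTower F H V]
    [Module.Finite F V]
    (κ : V →ₗ[F] V →ₗ[F] H) (halt : ∀ v : V, κ v v = 0)
    (hjac : HasJacobi F H V κ) :
    ∀ x y : V, κ x y ∈ K F H V 2 := by
  intro x y
  refine mem_range_map_subtype_iInf_ker _ _ fun vs => ?_
  have h₀ : sweedlerWedge F H V 3 vs (κ x y) = 0 := by
    rw [sweedlerWedge_three_apply]
    refine triple_apply_eq_zero_of_anticomm (wedgeOp F H V) (wedgeOp_anticomm hcc)
      (fun x y => 1 ⊗ₜ κ x y) (fun x y => ?_) (fun x y z => ?_) _ _ _ x y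
    · have h := halt (x + y)
      simp only [map_add, LinearMap.add_apply, halt, zero_add, add_zero] at h
      rw [← tmul_neg, eq_neg_of_add_eq_zero_right h]
    · simp only [wedgeOp_one_tmul, ← map_add, hjac x y z, map_zero]
  rw [LinearMap.rTensor_comp_apply, rTensor_sweedlerWedge_three_comul, h₀]
  simp
end
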